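/- For every nonempty compact Σ¹₁ subset A of ℕ^ℕ, there exists a uniformly Σ¹₁ family (Xₙ) of subsets of ℕ, each Xₙ being either all of ℕ or nonempty and finite, such that ∏ₙXₙ ≤_M A and, for every nonempty homogeneous Σ¹₁ set Y, if Y ≤_M A then Y ≤_M ∏ₙXₙ. -/

import Mathlib

open Set

/-- Baire space. -/
abbrev Baire : Type := ℕ → ℕ

/-- The length-`n` initial segment of `x : Baire`, as a finite sequence. -/
def pre (x : Baire) (n : ℕ) : List ℕ := (List.range n).map x

/-- A Turing functional, presented by a total computable monotone map on
finite sequences. -/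
structure TuringFunctional where
  φ : List ℕ → List ℕ
  computable : Computable φ
  mono : ∀ σ τ : List ℕ, σ <+: τ → φ σ <+: φ τ

/-- `Φ` is defined on `x` with value `y`: every coordinate of `y` is eventually
output by `Φ` on initial segments of `x`. -/
def TuringFunctional.Eval (Φ : TuringFunctional) (x y : Baire) : Prop :=
  ∀ n, ∃ m, (Φ.φ (pre x m))[n]? = some (y n)

/-- Medvedev reducibility: some Turing functional is defined on every element
of `Q` and maps `Q` into `P`. -/
def MedvedevLE (P Q : Set Baire) : Prop :=
  ∃ Φ : TuringFunctional, ∀ x ∈ Q, ∃ y ∈ P, Φ.Eval x y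

/-- Strict Medvedev reducibility. -/
def MedvedevLT (P Q : Set Baire) : Prop := MedvedevLE P Q ∧ ¬ MedvedevLE Q P

/-- The homogeneous set `∏ₙ Aₙ`. -/
def homProd (A : ℕ → Set ℕ) : Set Baire := {x | ∀ n, x n ∈ A n}

/-- A family `(Aₙ)` of subsets of `ℕ` is uniformly `Σ¹₁`. -/
def UniformlySigma11 (A : ℕ → Set ℕ) : Prop :=
  ∃ R : ℕ × ℕ → List ℕ → Bool, Computable₂ R ∧
    ∀ n m : ℕ, m ∈ A n ↔ ∃ y : Baire, ∀ k, R (n, m) (pre y k) = true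

/-- A subset of Baire space is (lightface) `Σ¹₁`. -/
def Sigma11Set (S : Set Baire) : Prop :=
  ∃ R : List ℕ → List ℕ → Bool, Computable₂ R ∧
    ∀ x, x ∈ S ↔ ∃ y : Baire, ∀ m, R (pre x m) (pre y m) = true

/-- A set of finite sequences is (lightface) `Σ¹₁`. -/
def Sigma11List (T : Set (List ℕ)) : Prop :=
  ∃ R : List ℕ → List ℕ → Bool, Computable₂ R ∧
    ∀ σ, σ ∈ T ↔ ∃ y : Baire, ∀ m, R σ (pre y m) = true

/-- A tree on `ℕ`: a set of finite sequences closed under prefixes. -/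
def IsTree (T : Set (List ℕ)) : Prop := ∀ σ ∈ T, ∀ τ : List ℕ, τ <+: σ → τ ∈ T

/-- The set `[T]` of infinite paths through `T`. -/
def paths (T : Set (List ℕ)) : Set Baire := {x | ∀ n, pre x n ∈ T}

/-- A subset of `ℕ × ℕ` is (lightface) `Σ¹₁`. -/
def Sigma11Pairs (A : Set (ℕ × ℕ)) : Prop :=
  ∃ R : ℕ × ℕ → List ℕ → Bool, Computable₂ R ∧
    ∀ p : ℕ × ℕ, p ∈ A ↔ ∃ y : Baire, ∀ k, R p (pre y k) = true

/-- A function `f : ℕ → ℕ` is `Δ¹₁`: its graph is both `Σ¹₁` and `Π¹₁`. -/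
def Delta11Fun (f : ℕ → ℕ) : Prop :=
  Sigma11Pairs {p : ℕ × ℕ | f p.1 = p.2} ∧ Sigma11Pairs {p : ℕ × ℕ | f p.1 ≠ p.2}

theorem pre_succ (x : Baire) (n : ℕ) : pre x (n + 1) = pre x n ++ [x n] := by
  simp [pre, List.range_succ]

theorem length_pre (x : Baire) (n : ℕ) : (pre x n).length = n := by
  simp [pre]

theorem pre_prefix_pre (x : Baire) {m n : ℕ} (h : m ≤ n) : pre x m <+: pre x n := by
  induction n, h using Nat.le_induction with
  | base => exact List.prefix_rfl
  | succ n _ ih => exact ih.trans (by rw [pre_succ]; exact List.prefix_append _ _)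

theorem take_pre (x : Baire) {m n : ℕ} (h : m ≤ n) : (pre x n).take m = pre x m := by
  have := List.prefix_iff_eq_take.1 (pre_prefix_pre x h)
  rwa [length_pre, eq_comm] at this

theorem map_pre (f : ℕ → ℕ) (x : Baire) (n : ℕ) :
    (pre x n).map f = pre (fun i => f (x i)) n := by
  simp [pre]

theorem isLocallyConstant_pre (n : ℕ) : IsLocallyConstant fun x : Baire => pre x n := by
  induction n with
  | zero => exact IsLocallyConstant.const []
  | succ n ih =>
    have hn : IsLocallyConstant fun x : Baire => x n :=
      (IsLocallyConstant.iff_continuous _).2 (continuous_apply n)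
    simp only [pre_succ]
    exact ih.comp₂ hn fun σ a => σ ++ [a]

/-- The set of codes of initial segments of length `n` of elements of `A`. -/
def preCodes (A : Set Baire) (n : ℕ) : Set ℕ := (fun x => Encodable.encode (pre x n)) '' A

theorem finite_preCodes {A : Set Baire} (hA : IsCompact A) (n : ℕ) : (preCodes A n).Finite :=
  (hA.image ((isLocallyConstant_pre n).comp Encodable.encode).continuous).finite_of_discrete

theorem Sigma11Set.uniformlySigma11_preCodes {A : Set Baire} (hA : Sigma11Set A) :
    UniformlySigma11 (preCodes A) := by
  obtain ⟨R, hR, hAR⟩ := hA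
  refine ⟨fun p τ => R (τ.map fun a => a.unpair.1) (τ.map fun a => a.unpair.2) &&
    (decide (τ.length < p.1) ||
      decide (Encodable.encode ((τ.map fun a => a.unpair.1).take p.1) = p.2)), ?_, ?_⟩
  · have h₁ : Primrec₂ fun (_ : ℕ × ℕ) (τ : List ℕ) => τ.map fun a => a.unpair.1 :=
      Primrec.list_map Primrec.snd ((Primrec.fst.comp Primrec.unpair).comp Primrec.snd).to₂
    have h₂ : Primrec₂ fun (_ : ℕ × ℕ) (τ : List ℕ) => τ.map fun a => a.unpair.2 :=
      Primrec.list_map Primrec.snd ((Primrec.snd.comp Primrec.unpair).comp Primrec.snd).to₂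
    have h₃ : Primrec fun q : (ℕ × ℕ) × List ℕ => decide (q.2.length < q.1.1) :=
      Primrec.nat_lt.decide.comp (Primrec.list_length.comp Primrec.snd)
        (Primrec.fst.comp Primrec.fst)
    have h₄ : Primrec fun q : (ℕ × ℕ) × List ℕ =>
        decide (Encodable.encode ((q.2.map fun a => a.unpair.1).take q.1.1) = q.1.2) :=
      Primrec.eq.decide.comp
        (Primrec.encode.comp (Primrec.list_take.comp (Primrec.fst.comp Primrec.fst) h₁))
        (Primrec.snd.comp Primrec.fst)
    exact (Primrec.and.to_comp.comp (hR.comp h₁.to_comp h₂.to_comp)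
      (Primrec.or.comp h₃ h₄).to_comp).to₂
  · intro n m
    constructor
    · rintro ⟨x, hx, rfl⟩
      obtain ⟨w, hw⟩ := (hAR x).1 hx
      refine ⟨fun i => Nat.pair (x i) (w i), fun k => ?_⟩
      rcases lt_or_ge k n with hk | hk
      · simp [map_pre, hw, length_pre, hk]
      · simp [map_pre, hw, length_pre, take_pre x hk]
    · rintro ⟨y, hy⟩
      simp only [map_pre, length_pre, Bool.and_eq_true, Bool.or_eq_true, decide_eq_true_eq] at hy
      refine ⟨fun i => (y i).unpair.1, (hAR _).2 ⟨_, fun k => (hy k).1⟩, ?_⟩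
      have := (hy n).2.resolve_left (lt_irrefl n)
      rwa [take_pre _ le_rfl] at this

/-- The functional taking `x` to the sequence of codes of its initial segments. -/
def preCodesFunctional : TuringFunctional where
  φ σ := (List.range σ.length).map fun s => Encodable.encode (σ.take s)
  computable :=
    (Primrec.list_map (Primrec.list_range.comp Primrec.list_length)
      (Primrec.encode.comp (Primrec.list_take.comp Primrec.snd Primrec.fst)).to₂).to_comp
  mono := by
    rintro σ _ ⟨ρ, rfl⟩
    rw [List.length_append, List.range_add, List.map_append]
    refine ⟨_, congrArg (· ++ _) (List.map_congr_left fun s hs => ?_)⟩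
    rw [List.take_append_of_le_length (List.mem_range.1 hs).le]

theorem medvedevLE_homProd_preCodes (A : Set Baire) : MedvedevLE (homProd (preCodes A)) A := by
  refine ⟨preCodesFunctional, fun x hx =>
    ⟨fun n => Encodable.encode (pre x n), fun n => ⟨x, hx, rfl⟩, fun n => ⟨n + 1, ?_⟩⟩⟩
  simp [preCodesFunctional, length_pre, take_pre x n.le_succ]

/-- One step of the computation of `TuringFunctional.search`: append the next output of `Φ`
if it can be read off from the finite sequence coded by `c`. -/
def TuringFunctional.searchStep (Φ : TuringFunctional) (acc : List ℕ) (c : ℕ) : List ℕ :=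
  acc ++ (Φ.φ (Denumerable.ofNat (List ℕ) c))[acc.length]?.toList

theorem TuringFunctional.computable_searchStep (Φ : TuringFunctional) :
    Computable₂ Φ.searchStep := by
  have h : Computable fun p : List ℕ × ℕ =>
      (Φ.φ (Denumerable.ofNat (List ℕ) p.2))[p.1.length]? :=
    Computable.list_getElem?.comp
      (Φ.computable.comp ((Computable.ofNat (List ℕ)).comp Computable.snd))
      (Computable.list_length.comp Computable.fst)
  refine (Computable.option_casesOn h Computable.fst
    (Computable.list_concat.comp (Computable.fst.comp Computable.fst)
      Computable.snd).to₂).of_eq fun p => ?_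
  rw [TuringFunctional.searchStep]
  cases (Φ.φ (Denumerable.ofNat (List ℕ) p.2))[p.1.length]? <;> simp

theorem Computable.list_foldl_nat {α : Type*} [Primcodable α] {f : α → ℕ → α}
    (hf : Computable₂ f) (a : α) : Computable fun τ : List ℕ => τ.foldl f a := by
  have h : Computable fun τ : List ℕ => Nat.rec (motive := fun _ => α) a
      (fun k acc => f acc (τ[k]?.getD 0)) τ.length :=
    Computable.nat_rec Computable.list_length (Computable.const a)
      (hf.comp (Computable.snd.comp Computable.snd)
        (Computable.option_getD
          (Computable.list_getElem?.comp Computable.fst (Computable.fst.comp Computable.snd))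
          (Computable.const 0))).to₂
  refine h.of_eq fun τ => ?_
  have key : ∀ k ≤ τ.length, Nat.rec (motive := fun _ => α) a
      (fun k acc => f acc (τ[k]?.getD 0)) k = (τ.take k).foldl f a := by
    intro k
    induction k with
    | zero => intro _; simp
    | succ k ih =>
      intro hk
      have hk' : k < τ.length := hk
      rw [List.take_succ_eq_append_getElem hk', List.foldl_append, ← ih hk'.le]
      simp [hk']
  simpa using key τ.length le_rfl

/-- The functional which reads a sequence of codes of finite sequences and collects,
coordinate by coordinate, the outputs of `Φ` on these finite sequences. -/
def TuringFunctional.search (Φ : TuringFunctional) : TuringFunctional where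
  φ τ := τ.foldl Φ.searchStep []
  computable := Computable.list_foldl_nat Φ.computable_searchStep []
  mono := by
    rintro σ _ ⟨ρ, rfl⟩
    rw [List.foldl_append]
    generalize σ.foldl Φ.searchStep [] = acc
    induction ρ generalizing acc with
    | nil => exact List.prefix_rfl
    | cons c ρ ih => exact (List.prefix_append _ _).trans (ih (Φ.searchStep acc c))

theorem TuringFunctional.search_pre_succ (Φ : TuringFunctional) (z : Baire) (k : ℕ) :
    Φ.search.φ (pre z (k + 1)) = Φ.searchStep (Φ.search.φ (pre z k)) (z k) := by
  simp [TuringFunctional.search, pre_succ]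

theorem TuringFunctional.Eval.eq_of_getElem? {Φ : TuringFunctional} {x y : Baire}
    (h : Φ.Eval x y) {m n v : ℕ} (hv : (Φ.φ (pre x m))[n]? = some v) : v = y n := by
  obtain ⟨m', hm'⟩ := h n
  have lift : ∀ {i w}, (Φ.φ (pre x i))[n]? = some w → i ≤ max m m' →
      (Φ.φ (pre x (max m m')))[n]? = some w := fun {i w} hw hi => by
    obtain ⟨ρ, hρ⟩ := Φ.mono _ _ (pre_prefix_pre x hi)
    rw [← hρ, List.getElem?_append_left (List.getElem?_eq_some_iff.1 hw).1, hw]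
  exact Option.some.inj ((lift hv (le_max_left _ _)).symm.trans (lift hm' (le_max_right _ _)))

theorem TuringFunctional.exists_uniform_length (Φ : TuringFunctional) {A : Set Baire}
    (hA : IsCompact A) (hΦ : ∀ x ∈ A, ∃ y, Φ.Eval x y) (n : ℕ) :
    ∃ s, ∀ t ≥ s, ∀ x ∈ A, n < (Φ.φ (pre x t)).length := by
  have hmono : Monotone fun s => {x : Baire | n < (Φ.φ (pre x s)).length} := fun s t hst x hx =>
    lt_of_lt_of_le hx (Φ.mono _ _ (pre_prefix_pre x hst)).length_le
  obtain ⟨s, hs⟩ := hA.elim_directed_cover (fun s => {x : Baire | n < (Φ.φ (pre x s)).length})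
    (fun s => isLocallyConstant_pre s {σ | n < (Φ.φ σ).length})
    (fun x hx => by
      obtain ⟨y, hy⟩ := hΦ x hx
      obtain ⟨m, hm⟩ := hy n
      exact mem_iUnion.2 ⟨m, (List.getElem?_eq_some_iff.1 hm).1⟩)
    hmono.directed_le
  exact ⟨s, fun t ht x hx => hmono ht (hs hx)⟩

theorem MedvedevLE.homProd_preCodes {A : Set Baire} (hA : IsCompact A) {Y : ℕ → Set ℕ}
    (h : MedvedevLE (homProd Y) A) : MedvedevLE (homProd Y) (homProd (preCodes A)) := by
  obtain ⟨Φ, hΦ⟩ := h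
  refine ⟨Φ.search, fun z hz => ?_⟩
  have hmem : ∀ k n v, (Φ.search.φ (pre z k))[n]? = some v → v ∈ Y n := by
    intro k
    induction k with
    | zero => intro n v hv; simp [TuringFunctional.search, pre] at hv
    | succ k ih =>
      intro n v hv
      obtain ⟨x, hx, hxz⟩ := hz k
      obtain ⟨y, hy, hxy⟩ := hΦ x hx
      rw [Φ.search_pre_succ, TuringFunctional.searchStep, ← hxz, Denumerable.ofNat_encode] at hv
      rcases lt_or_ge n (Φ.search.φ (pre z k)).length with hn | hn
      · rw [List.getElem?_append_left hn] at hv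
        exact ih n v hv
      · rw [List.getElem?_append_right hn] at hv
        cases ho : (Φ.φ (pre x k))[(Φ.search.φ (pre z k)).length]? with
        | none => simp [ho] at hv
        | some w =>
          rw [ho, Option.toList_some, List.getElem?_singleton] at hv
          split_ifs at hv with h0
          obtain rfl : n = (Φ.search.φ (pre z k)).length := by omega
          obtain rfl : w = v := by simpa using hv
          rw [hxy.eq_of_getElem? ho]
          exact hy _
  have hlen : ∀ n, ∃ k, n ≤ (Φ.search.φ (pre z k)).length := by
    intro n
    induction n with
    | zero => exact ⟨0, Nat.zero_le _⟩
    | succ n ih =>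
      obtain ⟨k, hk⟩ := ih
      obtain ⟨s, hs⟩ := Φ.exists_uniform_length hA (fun x hx => (hΦ x hx).imp fun _ => And.right) n
      refine ⟨max k s + 1, ?_⟩
      have hk' := hk.trans
        (Φ.search.mono _ _ (pre_prefix_pre z (le_max_left k s))).length_le
      obtain ⟨x, hx, hxz⟩ := hz (max k s)
      have hx' := hs _ (le_max_right k s) x hx
      rw [Φ.search_pre_succ, TuringFunctional.searchStep, ← hxz, Denumerable.ofNat_encode,
        List.length_append]
      rcases hk'.lt_or_eq with hlt | heq
      · omega
      · rw [← heq, List.getElem?_eq_getElem hx', Option.toList_some, List.length_singleton]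
  have hex : ∀ n, ∃ v, ∃ k, (Φ.search.φ (pre z k))[n]? = some v := fun n =>
    let ⟨k, hk⟩ := hlen (n + 1)
    ⟨_, k, List.getElem?_eq_getElem hk⟩
  choose y hy using hex
  exact ⟨y, fun n => let ⟨k, hk⟩ := hy n; hmem k n _ hk, hy⟩

/-- Below any nonempty compact `Σ¹₁` set `A` there is a greatest Medvedev degree
of a homogeneous `Σ¹₁` set, realized by an all-or-(nonempty-finite) product. -/
theorem exists_greatest_homogeneous_below_compact :
    ∀ A : Set Baire, A.Nonempty → IsCompact A → Sigma11Set A →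
      ∃ X : ℕ → Set ℕ, UniformlySigma11 X ∧
        (∀ n, X n = Set.univ ∨ ((X n).Nonempty ∧ (X n).Finite)) ∧
        MedvedevLE (homProd X) A ∧
        ∀ Y : ℕ → Set ℕ, UniformlySigma11 Y → (homProd Y).Nonempty →
          MedvedevLE (homProd Y) A → MedvedevLE (homProd Y) (homProd X) := by
  intro A hne hA hS
  exact ⟨preCodes A, hS.uniformlySigma11_preCodes,
    fun n => Or.inr ⟨hne.image _, finite_preCodes hA n⟩, medvedevLE_homProd_preCodes A,
    fun Y _ _ hY => hY.homProd_preCodes hA⟩
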